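/- Let A, B, C be finite-dimensional complex vector spaces and suppose T ∈ A⊗B⊗C has two expressions T = ∑_{i=1}^r u_i⊗v_i⊗w_i = ∑_{i=1}^r ũ_i⊗ṽ_i⊗w̃_i with all vectors u_i, v_i, w_i, ũ_i, ṽ_i, w̃_i nonzero. Let k_A, k_B, k_C denote the Kruskal ranks of the families (u_i), (v_i), (w_i). If 2r ≤ k_A + k_B + k_C − 2, then the corresponding sets of projective points coincide: {ℂ·u_i : 1 ≤ i ≤ r} = {ℂ·ũ_i : 1 ≤ i ≤ r}, {ℂ·v_i : 1 ≤ i ≤ r} = {ℂ·ṽ_i : 1 ≤ i ≤ r}, and {ℂ·w_i : 1 ≤ i ≤ r} = {ℂ·w̃_i : 1 ≤ i ≤ r} as sets of one-dimensional subspaces. -/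

import Mathlib

open TensorProduct Submodule

/-- Kruskal rank: the largest `k` such that every `k`-element subfamily is linearly independent. -/
noncomputable def kruskalRank {V : Type*} [AddCommGroup V] [Module ℂ V]
    {r : ℕ} (u : Fin r → V) : ℕ :=
  sSup {k | k ≤ r ∧ ∀ s : Finset (Fin r), s.card = k →
    LinearIndependent ℂ (fun i : {x // x ∈ s} => u i)}

section

open Module

variable {K A B ι : Type*} [Field K] [AddCommGroup A] [Module K A] [AddCommGroup B] [Module K B]

lemma exists_endomorphism_id_on_zero_on {P Q : Submodule K A} (h : Disjoint P Q) :
    ∃ g : A →ₗ[K] A, (∀ x ∈ P, g x = x) ∧ ∀ x ∈ Q, g x = 0 := by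
  obtain ⟨R, hR⟩ := Submodule.exists_isCompl (P ⊔ Q)
  have hc : IsCompl P (Q ⊔ R) := h.isCompl_sup_right_of_isCompl_sup_left hR
  refine ⟨P.projection (Q ⊔ R) hc, fun x hx => projection_apply_of_mem_left hc hx, fun x hx => ?_⟩
  rw [projection_apply_eq_zero_iff]
  exact mem_sup_left hx

lemma finrank_sup_le_finrank_map_mkQ_add [FiniteDimensional K B] (Q S : Submodule K B) :
    finrank K ↥(Q ⊔ S) ≤ finrank K (S.map Q.mkQ) + finrank K Q := by
  have h := (Q.mkQ.domRestrict (Q ⊔ S)).finrank_range_add_finrank_ker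
  have hr : LinearMap.range (Q.mkQ.domRestrict (Q ⊔ S)) = S.map Q.mkQ := by
    rw [LinearMap.range_domRestrict, Submodule.map_sup, Submodule.mkQ_map_self, bot_sup_eq]
  have hk : finrank K (LinearMap.ker (Q.mkQ.domRestrict (Q ⊔ S))) ≤ finrank K Q := by
    rw [← Submodule.finrank_map_subtype_eq]
    refine Submodule.finrank_mono ?_
    rintro _ ⟨x, hx, rfl⟩
    simpa using hx
  rw [hr] at h
  omega

lemma finrank_sup_span_add_finrank_sup_span_lt [FiniteDimensional K A] [FiniteDimensional K B]
    [Fintype ι] (P : Submodule K A) (Q : Submodule K B) (p : ι → A) (q : ι → B) (c : ι → K)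
    (hc : ∀ i, c i ≠ 0)
    (hmem : ∑ i, c i • p i ⊗ₜ[K] q i ∈ map₂ (TensorProduct.mk K A B) P Q)
    (hne : ∑ i, c i • p i ⊗ₜ[K] q i ≠ 0) :
    finrank K ↥(P ⊔ span K (Set.range p)) + finrank K ↥(Q ⊔ span K (Set.range q)) <
      finrank K P + finrank K Q + Fintype.card ι := by
  set F : (ι → K) →ₗ[K] B := Fintype.linearCombination K q with hF
  set L := LinearMap.ker (Q.mkQ ∘ₗ F) with hL
  have hrF : LinearMap.range F = span K (Set.range q) := Fintype.range_linearCombination K q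
  have hKL : LinearMap.ker F ≤ L := LinearMap.ker_le_ker_comp _ _
  have hlt : LinearMap.ker F < L := by
    refine lt_of_le_of_ne hKL fun heq => hne ?_
    have hdis : Disjoint (span K (Set.range q)) Q := by
      rw [Submodule.disjoint_def, ← hrF]
      rintro _ ⟨t, rfl⟩ hx
      have : t ∈ L := by simpa [hL] using hx
      rwa [← heq] at this
    obtain ⟨g, hg, hg0⟩ := exists_endomorphism_id_on_zero_on hdis
    have h0 : map₂ (TensorProduct.mk K A B) P Q ≤ LinearMap.ker (g.lTensor A) := by
      rw [map₂_le]
      intro m _ n hn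
      simp [hg0 n hn]
    have h1 := h0 hmem
    rw [LinearMap.mem_ker, map_sum] at h1
    rw [← h1]
    refine Finset.sum_congr rfl fun i _ => ?_
    simp [hg _ (subset_span (Set.mem_range_self i))]
  set Φ : P.dualAnnihilator →ₗ[K] (ι → K) :=
    LinearMap.pi fun i => c i • (Dual.eval K A (p i)) ∘ₗ P.dualAnnihilator.subtype with hΦ
  have hΦF : LinearMap.range Φ ≤ LinearMap.ker F := by
    rintro _ ⟨⟨f, hf⟩, rfl⟩
    rw [mem_dualAnnihilator] at hf
    have h0 : map₂ (TensorProduct.mk K A B) P Q ≤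
        LinearMap.ker ((TensorProduct.lid K B).toLinearMap ∘ₗ f.rTensor B) := by
      rw [map₂_le]
      intro m hm n _
      simp [hf m hm]
    have h1 := h0 hmem
    rw [LinearMap.mem_ker, map_sum] at h1
    simpa [hF, hΦ, Fintype.linearCombination_apply, mul_smul] using h1
  have hΦk : finrank K (LinearMap.ker Φ) ≤
      finrank K (P ⊔ span K (Set.range p)).dualAnnihilator := by
    rw [← Submodule.finrank_map_subtype_eq]
    refine Submodule.finrank_mono ?_
    rintro _ ⟨⟨f, hf⟩, hx, rfl⟩
    rw [dualAnnihilator_sup_eq]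
    refine ⟨hf, ?_⟩
    have hx' := fun i => congr_fun (LinearMap.mem_ker.1 hx) i
    simp only [SetLike.mem_coe, mem_dualAnnihilator]
    intro w hw
    induction hw using span_induction with
    | mem x hx =>
      obtain ⟨i, rfl⟩ := hx
      simpa [hΦ, hc i] using hx' i
    | zero => simp
    | add x y _ _ hx hy => rw [map_add, hx, hy, add_zero]
    | smul a x _ hx => simpa using Or.inr hx
  have e1 := LinearMap.finrank_range_add_finrank_ker (V := P.dualAnnihilator) (V₂ := ι → K) Φ
  have e2 := Subspace.finrank_add_finrank_dualAnnihilator_eq P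
  have e3 := Subspace.finrank_add_finrank_dualAnnihilator_eq (P ⊔ span K (Set.range p))
  have e4 := (Q.mkQ ∘ₗ F).finrank_range_add_finrank_ker
  have e5 := finrank_sup_le_finrank_map_mkQ_add Q (span K (Set.range q))
  have e6 := Submodule.finrank_lt_finrank_of_lt hlt
  have e7 := Submodule.finrank_mono hΦF
  rw [LinearMap.range_comp, hrF, ← hL, finrank_fintype_fun_eq_card] at e4
  omega

/-- The span of a family of vectors does not split along any partition of the index set `E`. -/
def SpanConnected (K : Type*) {A ι : Type*} [Field K] [AddCommGroup A] [Module K A]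
    [DecidableEq ι] (x : ι → A) (E : Finset ι) : Prop :=
  ∀ S ⊆ E, S.Nonempty → (E \ S).Nonempty →
    ¬ Disjoint (span K (x '' (S : Set ι))) (span K (x '' ((E \ S : Finset ι) : Set ι)))

lemma span_image_tmul_le (p : ι → A) (q : ι → B) (S : Set ι) :
    span K ((fun i => p i ⊗ₜ[K] q i) '' S) ≤
      map₂ (TensorProduct.mk K A B) (span K (p '' S)) (span K (q '' S)) := by
  rw [span_le]
  rintro _ ⟨i, hi, rfl⟩
  exact apply_mem_map₂ _ (subset_span ⟨i, hi, rfl⟩) (subset_span ⟨i, hi, rfl⟩)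

lemma SpanConnected.of_tmul_left [DecidableEq ι] {p : ι → A} {q : ι → B} {E : Finset ι}
    (h : SpanConnected K (fun i => p i ⊗ₜ[K] q i) E) : SpanConnected K p E := by
  intro S hS h1 h2 hdis
  refine h S hS h1 h2 ?_
  obtain ⟨g, hg, hg0⟩ := exists_endomorphism_id_on_zero_on hdis
  rw [Submodule.disjoint_def]
  intro z hz1 hz2
  have e1 : map₂ (TensorProduct.mk K A B) (span K (p '' (S : Set ι))) (span K (q '' (S : Set ι)))
      ≤ LinearMap.ker (g.rTensor B - LinearMap.id) := by
    rw [map₂_le]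
    intro m hm n _
    simp [hg m hm]
  have e2 : map₂ (TensorProduct.mk K A B) (span K (p '' ((E \ S : Finset ι) : Set ι)))
      (span K (q '' ((E \ S : Finset ι) : Set ι))) ≤ LinearMap.ker (g.rTensor B) := by
    rw [map₂_le]
    intro m hm n _
    simp [hg0 m hm]
  have f1 := e1 (span_image_tmul_le p q _ hz1)
  have f2 := e2 (span_image_tmul_le p q _ hz2)
  rw [LinearMap.mem_ker] at f1 f2
  simpa [f2] using f1

/-- If the span of a finite family meets `D` nontrivially, then so does that of some minimal
subfamily, which is moreover linearly independent. -/
lemma exists_minimal_not_disjoint_span [DecidableEq ι] (x : ι → A) (D : Submodule K A)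
    (E : Finset ι) (h : ¬ Disjoint D (span K (x '' (E : Set ι)))) :
    ∃ C ⊆ E, ¬ Disjoint D (span K (x '' (C : Set ι))) ∧
      (∀ a ∈ C, Disjoint D (span K (x '' ((C.erase a : Finset ι) : Set ι)))) ∧
      LinearIndepOn K x (C : Set ι) := by
  classical
  obtain ⟨C, hC, hmin⟩ := Finset.exists_min_image
    (E.powerset.filter fun C : Finset ι => ¬ Disjoint D (span K (x '' (C : Set ι)))) Finset.card
    ⟨E, by simpa using h⟩
  simp only [Finset.mem_filter, Finset.mem_powerset] at hC hmin
  have her : ∀ a ∈ C, Disjoint D (span K (x '' ((C.erase a : Finset ι) : Set ι))) := by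
    intro a ha
    by_contra hcon
    have := hmin (C.erase a) ⟨(Finset.erase_subset _ _).trans hC.1, hcon⟩
    have := Finset.card_erase_lt_of_mem ha
    omega
  refine ⟨C, hC.1, hC.2, her, ?_⟩
  rw [linearIndepOn_iff_notMem_span]
  intro a ha hmem
  refine hC.2 ?_
  have hsp : span K (x '' (C : Set ι)) ≤ span K (x '' ((C.erase a : Finset ι) : Set ι)) := by
    rw [span_le]
    rintro _ ⟨b, hb, rfl⟩
    by_cases hab : b = a
    · subst hab
      simpa using hmem
    · exact subset_span ⟨b, by simpa [hab] using hb, rfl⟩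
  exact (her a ha).mono_right hsp

lemma finrank_span_image_of_linearIndepOn {x : ι → A} {C : Finset ι}
    (h : LinearIndepOn K x (C : Set ι)) : finrank K (span K (x '' (C : Set ι))) = C.card := by
  rw [Set.image_eq_range]
  simpa using finrank_span_eq_card (R := K) (b := fun i : (C : Set ι) => x i) h

lemma SpanConnected.finrank_add_le [FiniteDimensional K A] [FiniteDimensional K B]
    [DecidableEq ι] {p : ι → A} {q : ι → B} {E : Finset ι} (hE : E.Nonempty)
    (hpq : ∀ i, p i ⊗ₜ[K] q i ≠ 0)
    (h : SpanConnected K (fun i => p i ⊗ₜ[K] q i) E) :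
    finrank K (span K (p '' (E : Set ι))) + finrank K (span K (q '' (E : Set ι))) ≤
      finrank K (span K ((fun i => p i ⊗ₜ[K] q i) '' (E : Set ι))) + 1 := by
  classical
  set x : ι → A ⊗[K] B := fun i => p i ⊗ₜ[K] q i with hx
  let good : Finset ι → Prop := fun D =>
    finrank K (span K (p '' (D : Set ι))) + finrank K (span K (q '' (D : Set ι))) ≤
      finrank K (span K (x '' (D : Set ι))) + 1
  obtain ⟨e, he⟩ := hE
  obtain ⟨D, hD, hmax⟩ := Finset.exists_max_image
    (E.powerset.filter fun D : Finset ι => D.Nonempty ∧ good D) Finset.card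
    ⟨{e}, by
      have h1 : finrank K (K ∙ x e) = 1 := finrank_span_singleton (hpq e)
      have h2 := finrank_span_le_card (R := K) ({p e} : Set A)
      have h3 := finrank_span_le_card (R := K) ({q e} : Set B)
      simp only [Set.toFinset_singleton, Finset.card_singleton] at h2 h3
      simp only [Finset.mem_filter, Finset.mem_powerset, good, Finset.singleton_subset_iff,
        Finset.singleton_nonempty]
      refine ⟨he, trivial, ?_⟩
      rw [Finset.coe_singleton, Set.image_singleton, Set.image_singleton, Set.image_singleton]
      omega⟩
  simp only [Finset.mem_filter, Finset.mem_powerset] at hD hmax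
  obtain ⟨hDE, hDne, hgood⟩ := hD
  rcases (E \ D).eq_empty_or_nonempty with hemp | hne
  · have : D = E := hDE.antisymm (Finset.sdiff_eq_empty_iff_subset.1 hemp)
    rwa [this] at hgood
  exfalso
  obtain ⟨C, hCE, hC, her, hli⟩ := exists_minimal_not_disjoint_span x _ _ (h D hDE hDne hne)
  have hCne : C.Nonempty := by
    rw [Finset.nonempty_iff_ne_empty]
    rintro rfl
    simp at hC
  have hCD : Disjoint D C := Finset.disjoint_of_subset_right hCE Finset.disjoint_sdiff
  have hbig : ¬ good (D ∪ C) := fun hg => by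
    have h1 := hmax (D ∪ C) ⟨Finset.union_subset hDE (hCE.trans Finset.sdiff_subset),
      hDne.mono Finset.subset_union_left, hg⟩
    rw [Finset.card_union_of_disjoint hCD] at h1
    have := hCne.card_pos
    omega
  apply hbig
  simp only [good] at hgood ⊢
  rw [Finset.coe_union, Set.image_union, Set.image_union, Set.image_union, span_union, span_union,
    span_union]
  obtain ⟨a, ha⟩ := hCne
  have r1 : finrank K (span K (x '' (D : Set ι))) + C.card ≤
      finrank K ↥(span K (x '' (D : Set ι)) ⊔ span K (x '' (C : Set ι))) + 1 := by
    have h1 := finrank_sup_add_finrank_inf_eq (span K (x '' (D : Set ι)))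
      (span K (x '' ((C.erase a : Finset ι) : Set ι)))
    rw [(her a ha).eq_bot, finrank_bot, finrank_span_image_of_linearIndepOn
      (C := C.erase a) (hli.mono (by simp)), Finset.card_erase_of_mem ha] at h1
    have h2 := Submodule.finrank_mono (sup_le_sup_left (span_mono (R := K)
      (Set.image_mono (f := x) (Finset.coe_subset.2 (Finset.erase_subset a C))))
      (span K (x '' (D : Set ι))))
    have := Finset.card_pos.2 ⟨a, ha⟩
    omega
  obtain ⟨y, hyD, hyC, hy0⟩ : ∃ y, y ∈ span K (x '' (D : Set ι)) ∧
      y ∈ span K (x '' (C : Set ι)) ∧ y ≠ 0 := by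
    rw [Submodule.disjoint_def] at hC
    push Not at hC
    exact hC
  obtain ⟨c, rfl⟩ := (mem_span_image_finset_iff_exists_fun' K).1 hyC
  have hc : ∀ i : C, c i ≠ 0 := by
    rintro ⟨i, hi⟩ hci
    refine hy0 ((Submodule.disjoint_def.1 (her i hi)) _ hyD ?_)
    rw [← Finset.add_sum_erase _ _ hi, hci, zero_smul, zero_add]
    exact sum_mem fun j hj => smul_mem _ _ (subset_span ⟨j, hj, rfl⟩)
  have key := finrank_sup_span_add_finrank_sup_span_lt (span K (p '' (D : Set ι)))
    (span K (q '' (D : Set ι))) (fun i : C => p i) (fun i : C => q i) (fun i : C => c i) hc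
    (by
      rw [Finset.sum_coe_sort C fun i => c i • p i ⊗ₜ[K] q i]
      exact span_image_tmul_le p q _ hyD)
    (by rwa [Finset.sum_coe_sort C fun i => c i • p i ⊗ₜ[K] q i])
  have hrange_p : Set.range (fun i : C => p i) = p '' (C : Set ι) := (Set.image_eq_range _ _).symm
  have hrange_q : Set.range (fun i : C => q i) = q '' (C : Set ι) := (Set.image_eq_range _ _).symm
  rw [hrange_p, hrange_q, Fintype.card_coe] at key
  omega

lemma mem_span_singleton_of_tmul_eq_tmul {a c : A} {b d : B} (h : a ⊗ₜ[K] b = c ⊗ₜ[K] d)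
    (hb : b ≠ 0) : a ∈ K ∙ c := by
  obtain ⟨f, hf⟩ := Projective.exists_dual_eq_one K hb
  have h1 := congr_arg (fun t => TensorProduct.rid K A (f.lTensor A t)) h
  simp only [LinearMap.lTensor_tmul, TensorProduct.rid_tmul, hf, one_smul] at h1
  exact mem_span_singleton.2 ⟨f d, h1.symm⟩

lemma tmul_ne_zero_of_ne_zero {a : A} {b : B} (ha : a ≠ 0) (hb : b ≠ 0) :
    a ⊗ₜ[K] b ≠ 0 := by
  intro h
  have := mem_span_singleton_of_tmul_eq_tmul (h.trans (TensorProduct.zero_tmul A b).symm) hb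
  exact ha (by simpa using this)

lemma span_singleton_eq_of_tmul_eq_tmul {a c : A} {b d : B} (h : a ⊗ₜ[K] b = c ⊗ₜ[K] d)
    (ha : a ≠ 0) (hb : b ≠ 0) : (K ∙ a) = (K ∙ c) ∧ (K ∙ b) = (K ∙ d) := by
  have hne : c ⊗ₜ[K] d ≠ 0 := h ▸ tmul_ne_zero_of_ne_zero ha hb
  have hc : c ≠ 0 := by rintro rfl; simp at hne
  have hd : d ≠ 0 := by rintro rfl; simp at hne
  have h' : b ⊗ₜ[K] a = d ⊗ₜ[K] c := by simpa using congr_arg (TensorProduct.comm K A B) h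
  constructor <;> apply le_antisymm <;> rw [span_singleton_le_iff_mem]
  · exact mem_span_singleton_of_tmul_eq_tmul h hb
  · exact mem_span_singleton_of_tmul_eq_tmul h.symm hd
  · exact mem_span_singleton_of_tmul_eq_tmul h' ha
  · exact mem_span_singleton_of_tmul_eq_tmul h'.symm hc

lemma finrank_span_image_lt_card_of_sum_eq_zero {x : ι → A} {E : Finset ι}
    (hE : E.Nonempty) (h : ∑ i ∈ E, x i = 0) :
    finrank K (span K (x '' (E : Set ι))) < E.card := by
  classical
  obtain ⟨e, he⟩ := hE
  have hle : span K (x '' (E : Set ι)) ≤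
      span K ((((E.erase e).image x : Finset A)) : Set A) := by
    rw [span_le]
    rintro _ ⟨b, hb, rfl⟩
    have hmem : ∀ j ∈ E.erase e, x j ∈ span K ((((E.erase e).image x : Finset A)) : Set A) :=
      fun j hj => subset_span (Finset.mem_coe.2 (Finset.mem_image_of_mem x hj))
    by_cases hbe : b = e
    · subst hbe
      rw [← Finset.add_sum_erase _ _ he] at h
      rw [eq_neg_of_add_eq_zero_left h]
      exact neg_mem (sum_mem hmem)
    · exact hmem b (Finset.mem_erase.2 ⟨hbe, hb⟩)
  have h1 := Submodule.finrank_mono hle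
  have h2 := finrank_span_finset_le_card (R := K) ((E.erase e).image x)
  have h3 := Finset.card_image_le (f := x) (s := E.erase e)
  have h4 := Finset.card_erase_lt_of_mem he
  rw [Set.finrank] at h2
  omega

end

section KruskalRank

open Module

variable {V : Type*} [AddCommGroup V] [Module ℂ V] {r : ℕ}

lemma kruskalRank_mem (u : Fin r → V) :
    kruskalRank u ≤ r ∧ ∀ s : Finset (Fin r), s.card = kruskalRank u →
      LinearIndependent ℂ (fun i : {x // x ∈ s} => u i) := by
  refine Nat.sSup_mem (s := {k | k ≤ r ∧ ∀ s : Finset (Fin r), s.card = k →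
    LinearIndependent ℂ (fun i : {x // x ∈ s} => u i)}) ⟨0, Nat.zero_le _, fun s hs => ?_⟩
    ⟨r, fun k hk => hk.1⟩
  rw [Finset.card_eq_zero] at hs
  subst hs
  exact linearIndependent_empty_type

lemma min_kruskalRank_card_le_finrank [FiniteDimensional ℂ V] (u : Fin r → V)
    (Q : Finset (Fin r)) :
    min (kruskalRank u) Q.card ≤ finrank ℂ (span ℂ (u '' (Q : Set (Fin r)))) := by
  obtain ⟨hr, hli⟩ := kruskalRank_mem u
  rcases le_total (kruskalRank u) Q.card with h | h
  · obtain ⟨s, hs, hcard⟩ := Finset.exists_subset_card_eq h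
    rw [min_eq_left h, ← hcard, ← finrank_span_image_of_linearIndepOn (hli s hcard)]
    exact Submodule.finrank_mono (span_mono (Set.image_mono (Finset.coe_subset.2 hs)))
  · obtain ⟨s, hs, hcard⟩ := Finset.exists_superset_card_eq h (by simpa using hr)
    have hs' : LinearIndepOn ℂ u (s : Set (Fin r)) := hli s hcard
    rw [min_eq_right h, finrank_span_image_of_linearIndepOn (hs'.mono (Finset.coe_subset.2 hs))]

lemma min_kruskalRank_inl_card_toLeft_le_finrank [FiniteDimensional ℂ V]
    (t : Fin r ⊕ Fin r → V) (E : Finset (Fin r ⊕ Fin r)) :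
    min (kruskalRank (t ∘ Sum.inl)) E.toLeft.card ≤
      finrank ℂ (span ℂ (t '' (E : Set (Fin r ⊕ Fin r)))) := by
  refine (min_kruskalRank_card_le_finrank _ _).trans (Submodule.finrank_mono (span_mono ?_))
  rintro _ ⟨i, hi, rfl⟩
  exact ⟨Sum.inl i, by simpa using hi, rfl⟩

end KruskalRank

section ZeroSum

open Module

variable {A B C : Type*} [AddCommGroup A] [Module ℂ A] [AddCommGroup B] [Module ℂ B]
  [AddCommGroup C] [Module ℂ C]
  [FiniteDimensional ℂ A] [FiniteDimensional ℂ B] [FiniteDimensional ℂ C] {r : ℕ}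

lemma card_toLeft_le_one_of_spanConnected {x : Fin r ⊕ Fin r → A} {y : Fin r ⊕ Fin r → B}
    {z : Fin r ⊕ Fin r → C} (hx : ∀ i, x i ≠ 0) (hy : ∀ i, y i ≠ 0) (hz : ∀ i, z i ≠ 0)
    (hk : 2 * r + 2 ≤ kruskalRank (x ∘ Sum.inl) + kruskalRank (y ∘ Sum.inl) +
      kruskalRank (z ∘ Sum.inl))
    {E : Finset (Fin r ⊕ Fin r)}
    (hconn : SpanConnected ℂ (fun i => (x i ⊗ₜ[ℂ] y i) ⊗ₜ[ℂ] z i) E)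
    (hsum : ∑ i ∈ E, (x i ⊗ₜ[ℂ] y i) ⊗ₜ[ℂ] z i = 0)
    (hcard : E.toRight.card ≤ E.toLeft.card) : E.toLeft.card ≤ 1 := by
  by_contra! hq
  have hE : E.Nonempty := by
    obtain ⟨i, hi⟩ := Finset.card_pos.1 (zero_lt_one.trans hq)
    exact ⟨_, Finset.mem_toLeft.1 hi⟩
  have hxy : ∀ i, x i ⊗ₜ[ℂ] y i ≠ 0 := fun i => tmul_ne_zero_of_ne_zero (hx i) (hy i)
  have h1 := SpanConnected.finrank_add_le hE
    (fun i => tmul_ne_zero_of_ne_zero (hxy i) (hz i)) hconn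
  have h2 := SpanConnected.finrank_add_le hE hxy hconn.of_tmul_left
  have h3 := finrank_span_image_lt_card_of_sum_eq_zero (K := ℂ) hE hsum
  have hA := min_kruskalRank_inl_card_toLeft_le_finrank x E
  have hB := min_kruskalRank_inl_card_toLeft_le_finrank y E
  have hC := min_kruskalRank_inl_card_toLeft_le_finrank z E
  have kA := (kruskalRank_mem (x ∘ Sum.inl)).1
  have kB := (kruskalRank_mem (y ∘ Sum.inl)).1
  have kC := (kruskalRank_mem (z ∘ Sum.inl)).1
  have hqr : E.toLeft.card ≤ r := by simpa using Finset.card_le_univ E.toLeft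
  have hc := E.card_toLeft_add_card_toRight
  omega

lemma card_toLeft_le_card_toRight_of_sum_eq_zero {x : Fin r ⊕ Fin r → A}
    {y : Fin r ⊕ Fin r → B}
    {z : Fin r ⊕ Fin r → C} (hx : ∀ i, x i ≠ 0) (hy : ∀ i, y i ≠ 0) (hz : ∀ i, z i ≠ 0)
    (hk : 2 * r + 2 ≤ kruskalRank (x ∘ Sum.inl) + kruskalRank (y ∘ Sum.inl) +
      kruskalRank (z ∘ Sum.inl))
    {t : Fin r ⊕ Fin r → (A ⊗[ℂ] B) ⊗[ℂ] C} (ht : t = fun i => (x i ⊗ₜ[ℂ] y i) ⊗ₜ[ℂ] z i)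
    (E : Finset (Fin r ⊕ Fin r)) (hsum : ∑ i ∈ E, t i = 0) :
    E.toLeft.card ≤ E.toRight.card ∧ (E.toLeft.card = E.toRight.card →
      (∀ i, Sum.inl i ∈ E → ∃ j, t (Sum.inl i) + t (Sum.inr j) = 0) ∧
      ∀ j, Sum.inr j ∈ E → ∃ i, t (Sum.inl i) + t (Sum.inr j) = 0) := by
  induction E using Finset.strongInduction with
  | H E ih =>
  by_cases hconn : SpanConnected ℂ t E
  · by_cases hcard : E.toRight.card ≤ E.toLeft.card
    · subst ht
      have hle := card_toLeft_le_one_of_spanConnected hx hy hz hk hconn hsum hcard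
      have hEd : E.toLeft.disjSum E.toRight = E := E.toLeft_disjSum_toRight
      rw [← hEd, Finset.sum_disjSum] at hsum
      rcases Nat.le_one_iff_eq_zero_or_eq_one.1 hle with h0 | h1
      · have h0' : E.toRight.card = 0 := by omega
        rw [Finset.card_eq_zero] at h0 h0'
        have : E = ∅ := by rw [← hEd, h0, h0']; rfl
        subst this
        exact ⟨by rw [h0, h0'], fun _ =>
          ⟨fun i hi => absurd hi (Finset.notMem_empty _),
            fun j hj => absurd hj (Finset.notMem_empty _)⟩⟩
      · obtain ⟨i, hi⟩ := Finset.card_eq_one.1 h1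
        rcases Nat.le_one_iff_eq_zero_or_eq_one.1 (hcard.trans hle) with h0 | h2
        · rw [Finset.card_eq_zero] at h0
          rw [hi, h0, Finset.sum_singleton, Finset.sum_empty, add_zero] at hsum
          exact absurd hsum
            (tmul_ne_zero_of_ne_zero (tmul_ne_zero_of_ne_zero (hx _) (hy _)) (hz _))
        · obtain ⟨j, hj⟩ := Finset.card_eq_one.1 h2
          rw [hi, hj, Finset.sum_singleton, Finset.sum_singleton] at hsum
          refine ⟨by omega, fun _ => ⟨fun i' hi' => ?_, fun j' hj' => ?_⟩⟩
          · rw [← Finset.mem_toLeft, hi, Finset.mem_singleton] at hi'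
            exact ⟨j, hi' ▸ hsum⟩
          · rw [← Finset.mem_toRight, hj, Finset.mem_singleton] at hj'
            exact ⟨i, hj' ▸ hsum⟩
    · exact ⟨by omega, fun h => by omega⟩
  · simp only [SpanConnected, not_forall, not_not] at hconn
    obtain ⟨S, hS, hSne, hSne', hdis⟩ := hconn
    have hadd := Finset.sum_sdiff hS (f := t)
    rw [hsum] at hadd
    have hmem : ∀ F : Finset (Fin r ⊕ Fin r),
        ∑ i ∈ F, t i ∈ span ℂ (t '' (F : Set (Fin r ⊕ Fin r))) :=
      fun F => sum_mem fun i hi => subset_span ⟨i, hi, rfl⟩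
    have hS0 : ∑ i ∈ S, t i = 0 := by
      refine Submodule.disjoint_def.1 hdis _ (hmem S) ?_
      rw [eq_neg_of_add_eq_zero_right hadd]
      exact neg_mem (hmem _)
    have hS0' : ∑ i ∈ E \ S, t i = 0 := by rwa [hS0, add_zero] at hadd
    have hlt : S ⊂ E := hS.ssubset_of_ne fun h => by simp [h] at hSne'
    obtain ⟨a1, a2⟩ := ih S hlt hS0
    obtain ⟨b1, b2⟩ := ih (E \ S) (Finset.sdiff_ssubset hS hSne) hS0'
    have cl : (E \ S).toLeft.card + S.toLeft.card = E.toLeft.card := by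
      rw [Finset.toLeft_sdiff]
      exact Finset.card_sdiff_add_card_eq_card (Finset.toLeft_subset_toLeft hS)
    have cr : (E \ S).toRight.card + S.toRight.card = E.toRight.card := by
      rw [Finset.toRight_sdiff]
      exact Finset.card_sdiff_add_card_eq_card (Finset.toRight_subset_toRight hS)
    refine ⟨by omega, fun heq => ?_⟩
    obtain ⟨a3, a4⟩ := a2 (by omega)
    obtain ⟨b3, b4⟩ := b2 (by omega)
    refine ⟨fun i hi => ?_, fun j hj => ?_⟩
    · by_cases h : Sum.inl i ∈ S
      · exact a3 i h
      · exact b3 i (Finset.mem_sdiff.2 ⟨hi, h⟩)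
    · by_cases h : Sum.inr j ∈ S
      · exact a4 j h
      · exact b4 j (Finset.mem_sdiff.2 ⟨hj, h⟩)

end ZeroSum

/-- If `T ∈ A ⊗ B ⊗ C` has two length-`r` expressions into simple tensors of nonzero
vectors, and `2r ≤ k_A + k_B + k_C − 2`, then the corresponding sets of projective points
in each factor coincide. -/
theorem kruskal_projective_points_coincide {A B C : Type*}
    [AddCommGroup A] [Module ℂ A] [AddCommGroup B] [Module ℂ B]
    [AddCommGroup C] [Module ℂ C]
    [FiniteDimensional ℂ A] [FiniteDimensional ℂ B] [FiniteDimensional ℂ C]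
    {r : ℕ} (u u' : Fin r → A) (v v' : Fin r → B) (w w' : Fin r → C)
    (hu : ∀ i, u i ≠ 0) (hv : ∀ i, v i ≠ 0) (hw : ∀ i, w i ≠ 0)
    (hu' : ∀ i, u' i ≠ 0) (hv' : ∀ i, v' i ≠ 0) (hw' : ∀ i, w' i ≠ 0)
    (T : (A ⊗[ℂ] B) ⊗[ℂ] C)
    (hT : T = ∑ i, (u i ⊗ₜ[ℂ] v i) ⊗ₜ[ℂ] w i)
    (hT' : T = ∑ i, (u' i ⊗ₜ[ℂ] v' i) ⊗ₜ[ℂ] w' i)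
    (hk : 2 * r + 2 ≤ kruskalRank u + kruskalRank v + kruskalRank w) :
    (Set.range fun i => (ℂ ∙ u i : Submodule ℂ A)) = (Set.range fun i => (ℂ ∙ u' i : Submodule ℂ A)) ∧
    (Set.range fun i => (ℂ ∙ v i : Submodule ℂ B)) = (Set.range fun i => (ℂ ∙ v' i : Submodule ℂ B)) ∧
    (Set.range fun i => (ℂ ∙ w i : Submodule ℂ C)) = (Set.range fun i => (ℂ ∙ w' i : Submodule ℂ C)) := by
  
  set x : Fin r ⊕ Fin r → A := Sum.elim u (-u') with hx
  set y : Fin r ⊕ Fin r → B := Sum.elim v v' with hy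
  set z : Fin r ⊕ Fin r → C := Sum.elim w w' with hz
  have hsum : ∑ i, (x i ⊗ₜ[ℂ] y i) ⊗ₜ[ℂ] z i = 0 := by
    rw [Fintype.sum_sum_type]
    simp only [hx, hy, hz, Sum.elim_inl, Sum.elim_inr, Pi.neg_apply, TensorProduct.neg_tmul,
      Finset.sum_neg_distrib]
    rw [← hT, ← hT', add_neg_cancel]
  obtain ⟨-, hmatch⟩ := card_toLeft_le_card_toRight_of_sum_eq_zero (x := x) (y := y) (z := z)
    (by rintro (i | i) <;> simp [hx, hu, hu']) (by rintro (i | i) <;> simp [hy, hv, hv'])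
    (by rintro (i | i) <;> simp [hz, hw, hw']) hk rfl Finset.univ hsum
  obtain ⟨hl, hr⟩ := hmatch (by simp)
  have hpair : ∀ i j, (x (Sum.inl i) ⊗ₜ[ℂ] y (Sum.inl i)) ⊗ₜ[ℂ] z (Sum.inl i) +
      (x (Sum.inr j) ⊗ₜ[ℂ] y (Sum.inr j)) ⊗ₜ[ℂ] z (Sum.inr j) = 0 →
      (ℂ ∙ u i) = (ℂ ∙ u' j) ∧ (ℂ ∙ v i) = (ℂ ∙ v' j) ∧ (ℂ ∙ w i) = (ℂ ∙ w' j) := by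
    intro i j h
    simp only [hx, hy, hz, Sum.elim_inl, Sum.elim_inr, Pi.neg_apply, TensorProduct.neg_tmul] at h
    rw [← sub_eq_add_neg, sub_eq_zero] at h
    have huv : u i ⊗ₜ[ℂ] v i ≠ 0 := tmul_ne_zero_of_ne_zero (hu i) (hv i)
    obtain ⟨h1, h2⟩ := span_singleton_eq_of_tmul_eq_tmul h huv (hw i)
    obtain ⟨s, hs⟩ := mem_span_singleton.1 (h1 ▸ mem_span_singleton_self (u i ⊗ₜ[ℂ] v i))
    have hs0 : s ≠ 0 := by
      rintro rfl
      exact huv (by rw [← hs, zero_smul])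
    rw [TensorProduct.smul_tmul'] at hs
    obtain ⟨h3, h4⟩ := span_singleton_eq_of_tmul_eq_tmul hs.symm (hu i) (hv i)
    exact ⟨h3.trans (span_singleton_smul_eq (IsUnit.mk0 s hs0) _), h4, h2⟩
  choose f hf using fun i => hl i (Finset.mem_univ _)
  choose g hg using fun j => hr j (Finset.mem_univ _)
  have hf' := fun i => hpair _ _ (hf i)
  have hg' := fun j => hpair _ _ (hg j)
  refine ⟨?_, ?_, ?_⟩ <;> apply Set.Subset.antisymm <;> rintro _ ⟨i, rfl⟩
  · exact ⟨f i, (hf' i).1.symm⟩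
  · exact ⟨g i, (hg' i).1⟩
  · exact ⟨f i, (hf' i).2.1.symm⟩
  · exact ⟨g i, (hg' i).2.1⟩
  · exact ⟨f i, (hf' i).2.2.symm⟩
  · exact ⟨g i, (hg' i).2.2⟩
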